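/- arXiv:1908.00565 — 8 statements merged into one kernel-verified Lean document; each statement's English description precedes it below -/
import Mathlib

section
/- Let a, b ∈ ℂ and x, y ∈ ℂ⁴ with D := x₁ − y₄ + x₂y₃ ≠ 0, and let (u, v) = Y_{a,b}(x, y). Then for every λ ∈ ℂ the matrix refactorisation identity L_a(u;λ) · L_b(v;λ) = L_b(y;λ) · L_a(x;λ) holds. -/
/-- The Lax matrix `L_a(x;λ)` of the Boussinesq-type Yang–Baxter map:
the 3×3 complex matrix with rows `(−x₃, 1, 0)`, `(−x₄, 0, 1)`,
`(a − x₁x₃ − x₂x₄ − λ, x₁, x₂)`. -/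
noncomputable def LaxBSQ (a lam x1 x2 x3 x4 : ℂ) : Matrix (Fin 3) (Fin 3) ℂ :=
  !![-x3, 1, 0;
     -x4, 0, 1;
     a - x1 * x3 - x2 * x4 - lam, x1, x2]

/-- If `(u,v) = Y_{a,b}(x,y)` (with nonzero denominator `D = x₁ − y₄ + x₂y₃`), then
`L_a(u;λ) L_b(v;λ) = L_b(y;λ) L_a(x;λ)` for every `λ`. -/
theorem laxBSQ_refactorisation
    (a b x1 x2 x3 x4 y1 y2 y3 y4 u1 u2 u3 u4 v1 v2 v3 v4 : ℂ)
    (hD : x1 - y4 + x2 * y3 ≠ 0)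
    (hu1 : u1 = y1 + (a - b) * x2 / (x1 - y4 + x2 * y3))
    (hu2 : u2 = y2 + (b - a) / (x1 - y4 + x2 * y3))
    (hu3 : u3 = y3)
    (hu4 : u4 = y4)
    (hv1 : v1 = x1)
    (hv2 : v2 = x2)
    (hv3 : v3 = x3 + (b - a) / (x1 - y4 + x2 * y3))
    (hv4 : v4 = x4 + (b - a) * y3 / (x1 - y4 + x2 * y3)) :
    ∀ lam : ℂ,
      LaxBSQ a lam u1 u2 u3 u4 * LaxBSQ b lam v1 v2 v3 v4 =
        LaxBSQ b lam y1 y2 y3 y4 * LaxBSQ a lam x1 x2 x3 x4 := by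
  intro lam
  subst u1 u2 u3 u4 v1 v2 v3 v4
  ext i j
  fin_cases i <;> fin_cases j <;>
    simp [LaxBSQ, Matrix.mul_apply, Fin.sum_univ_three] <;> field_simp <;> ring
end

section
/- Let a, b ∈ ℂ and x, y ∈ ℂ⁴ with D := x₁ − y₄ + x₂y₃ ≠ 0. Suppose u, v ∈ ℂ⁴ satisfy L_a(u;λ) · L_b(v;λ) = L_b(y;λ) · L_a(x;λ) for every λ ∈ ℂ. Then u₁ = y₁ + (a−b)x₂/D, u₂ = y₂ + (b−a)/D, u₃ = y₃, v₂ = x₂, v₃ = x₃ + (b−a)/D, v₄ = x₄ + (b−a)y₃/D, and u₄ = y₄ + v₁ − x₁. -/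
/-- If `u, v` satisfy the refactorisation `L_a(u;λ) L_b(v;λ) = L_b(y;λ) L_a(x;λ)`
for every `λ` (with `D = x₁ − y₄ + x₂y₃ ≠ 0`), then `u₁, u₂, u₃, v₂, v₃, v₄` are
given by the Boussinesq-type Yang–Baxter correspondence and `u₄ = y₄ + v₁ − x₁`. -/
theorem laxBSQ_refactorisation_implies_map
    (a b x1 x2 x3 x4 y1 y2 y3 y4 u1 u2 u3 u4 v1 v2 v3 v4 : ℂ)
    (hD : x1 - y4 + x2 * y3 ≠ 0)
    (h : ∀ lam : ℂ,
      LaxBSQ a lam u1 u2 u3 u4 * LaxBSQ b lam v1 v2 v3 v4 =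
        LaxBSQ b lam y1 y2 y3 y4 * LaxBSQ a lam x1 x2 x3 x4) :
    u1 = y1 + (a - b) * x2 / (x1 - y4 + x2 * y3) ∧
    u2 = y2 + (b - a) / (x1 - y4 + x2 * y3) ∧
    u3 = y3 ∧
    v2 = x2 ∧
    v3 = x3 + (b - a) / (x1 - y4 + x2 * y3) ∧
    v4 = x4 + (b - a) * y3 / (x1 - y4 + x2 * y3) ∧
    u4 = y4 + v1 - x1 := by
  have h0 := h 0
  have h1 := h 1
  have entry : ∀ i j : Fin 3, _ := fun i j => congrFun (congrFun h0 i) j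
  have e00 := entry 0 0
  have e01 := entry 0 1
  have e10 := entry 1 0
  have e11 := entry 1 1
  have e12 := entry 1 2
  have e20 := entry 2 0
  have e22 := entry 2 2
  have f20 := congrFun (congrFun h1 2) 0
  simp [LaxBSQ, Matrix.mul_apply, Fin.sum_univ_three] at e00 e01 e10 e11 e12 e20 e22 f20
  subst e01 e12
  have hv3 : v3 = x3 + (u2 - y2) := by linear_combination f20 - e20
  have hv4 : v4 = x4 + u3 * (u2 - y2) := by linear_combination u3 * hv3 - e00
  have hs : u2 - y2 = (b - a) / (x1 - y4 + v2 * u3) := by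
    rw [eq_div_iff hD]
    linear_combination -e10 - e11 * v3 - (x1 - y4) * hv3 - v2 * hv4
  refine ⟨?_, ?_, rfl, rfl, ?_, ?_, ?_⟩
  · linear_combination e22 - v2 * hs
  · linear_combination hs
  · linear_combination hv3 + hs
  · linear_combination hv4 + u3 * hs
  · linear_combination -e11
end

section
/- The map Y_{a,b} satisfies the parametric set-theoretical Yang–Baxter equation: for all parameters a, b, c ∈ ℂ and all x, y, z ∈ ℂ⁴ such that the denominator of every one of the six applications of Y occurring in the two compositions below is nonzero, one has Y²³_{b,c} ∘ Y¹³_{a,c} ∘ Y¹²_{a,b} (x,y,z) = Y¹²_{a,b} ∘ Y¹³_{a,c} ∘ Y²³_{b,c} (x,y,z), where Y¹²_{a,b}(x,y,z) = (Y_{a,b}(x,y), z), Y²³_{b,c}(x,y,z) = (x, Y_{b,c}(y,z)), and Y¹³_{a,c}(x,y,z) = (u, y, w) with (u, w) = Y_{a,c}(x,z). -/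
/-- The denominator `D = x₁ − y₄ + x₂y₃` of the Boussinesq-type Yang–Baxter map
(components are indexed `0,…,3`). -/
noncomputable def Dden (x y : Fin 4 → ℂ) : ℂ := x 0 - y 3 + x 1 * y 2

/-- The Boussinesq-type Yang–Baxter map `Y_{a,b} : (x,y) ↦ (u,v)`. -/
noncomputable def Ymap (a b : ℂ) (x y : Fin 4 → ℂ) : (Fin 4 → ℂ) × (Fin 4 → ℂ) :=
  (![y 0 + (a - b) * x 1 / Dden x y,
     y 1 + (b - a) / Dden x y,
     y 2,
     y 3],
   ![x 0,
     x 1,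
     x 2 + (b - a) / Dden x y,
     x 3 + (b - a) * y 2 / Dden x y])

/-- `Y¹²_{a,b}` acts by `Y_{a,b}` on the first two factors. -/
noncomputable def Y12 (a b : ℂ) (t : (Fin 4 → ℂ) × (Fin 4 → ℂ) × (Fin 4 → ℂ)) :
    (Fin 4 → ℂ) × (Fin 4 → ℂ) × (Fin 4 → ℂ) :=
  ((Ymap a b t.1 t.2.1).1, (Ymap a b t.1 t.2.1).2, t.2.2)

/-- `Y²³_{b,c}` acts by `Y_{b,c}` on the last two factors. -/
noncomputable def Y23 (b c : ℂ) (t : (Fin 4 → ℂ) × (Fin 4 → ℂ) × (Fin 4 → ℂ)) :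
    (Fin 4 → ℂ) × (Fin 4 → ℂ) × (Fin 4 → ℂ) :=
  (t.1, (Ymap b c t.2.1 t.2.2).1, (Ymap b c t.2.1 t.2.2).2)

/-- `Y¹³_{a,c}` acts by `Y_{a,c}` on the first and third factors. -/
noncomputable def Y13 (a c : ℂ) (t : (Fin 4 → ℂ) × (Fin 4 → ℂ) × (Fin 4 → ℂ)) :
    (Fin 4 → ℂ) × (Fin 4 → ℂ) × (Fin 4 → ℂ) :=
  ((Ymap a c t.1 t.2.2).1, t.2.1, (Ymap a c t.1 t.2.2).2)

/-- Adding a multiple of `(p * q + s * k)⁻¹` to `p` multiplies it by a ratio of two expressions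
of the form `p * q + _ * k`. -/
lemma add_mul_div_mul_div_eq {K : Type*} [Field K] {p q k s t : K} (h : p * q + s * k ≠ 0) :
    p + (t - s) * k / ((p * q + s * k) / p) =
      p * (p * q + t * k) / (p * q + s * k) := by
  have hk : p * q + t * k = (p * q + s * k) + (t - s) * k := by ring
  rw [hk, div_div_eq_mul_div]
  generalize p * q + s * k = r at h ⊢
  field_simp

/-- The Boussinesq-type Yang–Baxter map satisfies the parametric set-theoretical
Yang–Baxter equation `Y²³_{b,c} ∘ Y¹³_{a,c} ∘ Y¹²_{a,b} = Y¹²_{a,b} ∘ Y¹³_{a,c} ∘ Y²³_{b,c}`,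
provided all six denominators occurring in the two compositions are nonzero. -/
theorem Ymap_yangBaxter (a b c : ℂ) (x y z : Fin 4 → ℂ)
    -- denominators of the left-hand composition Y²³ ∘ Y¹³ ∘ Y¹²
    (h1 : Dden x y ≠ 0)
    (h2 : Dden (Y12 a b (x, y, z)).1 (Y12 a b (x, y, z)).2.2 ≠ 0)
    (h3 : Dden (Y13 a c (Y12 a b (x, y, z))).2.1
              (Y13 a c (Y12 a b (x, y, z))).2.2 ≠ 0)
    -- denominators of the right-hand composition Y¹² ∘ Y¹³ ∘ Y²³
    (h4 : Dden y z ≠ 0)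
    (h5 : Dden (Y23 b c (x, y, z)).1 (Y23 b c (x, y, z)).2.2 ≠ 0)
    (h6 : Dden (Y13 a c (Y23 b c (x, y, z))).1
              (Y13 a c (Y23 b c (x, y, z))).2.1 ≠ 0) :
    Y23 b c (Y13 a c (Y12 a b (x, y, z))) = Y12 a b (Y13 a c (Y23 b c (x, y, z))) := by
  have e2 : Dden (Y12 a b (x, y, z)).1 (Y12 a b (x, y, z)).2.2
      = (Dden x y * Dden y z + (a - b) * (x 1 - z 2)) / Dden x y := by
    simp only [Y12, Ymap]
    generalize hp : Dden x y = p at h1 ⊢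
    simp only [Dden, Matrix.cons_val]
    field_simp
    ring
  have e5 : Dden (Y23 b c (x, y, z)).1 (Y23 b c (x, y, z)).2.2
      = (Dden x y * Dden y z + (c - b) * (x 1 - z 2)) / Dden y z := by
    simp only [Y23, Ymap]
    generalize hq : Dden y z = q at h4 ⊢
    simp only [Dden, Matrix.cons_val]
    field_simp
    ring
  have hP : Dden x y * Dden y z + (a - b) * (x 1 - z 2) ≠ 0 := by
    intro h; simp [e2, h] at h2
  have hQ : Dden x y * Dden y z + (c - b) * (x 1 - z 2) ≠ 0 := by
    intro h; simp [e5, h] at h5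
  have e3 : Dden (Y13 a c (Y12 a b (x, y, z))).2.1 (Y13 a c (Y12 a b (x, y, z))).2.2
      = Dden x y * (Dden x y * Dden y z + (c - b) * (x 1 - z 2))
          / (Dden x y * Dden y z + (a - b) * (x 1 - z 2)) := by
    rw [← add_mul_div_mul_div_eq hP, ← e2]
    simp only [Y13]
    generalize hd : Dden (Y12 a b (x, y, z)).1 (Y12 a b (x, y, z)).2.2 = d
    simp only [Ymap, hd]
    simp only [Y12, Ymap, Dden, Matrix.cons_val]
    ring
  have e6 : Dden (Y13 a c (Y23 b c (x, y, z))).1 (Y13 a c (Y23 b c (x, y, z))).2.1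
      = Dden y z * (Dden x y * Dden y z + (a - b) * (x 1 - z 2))
          / (Dden x y * Dden y z + (c - b) * (x 1 - z 2)) := by
    rw [mul_comm (Dden x y)] at hQ e5 ⊢
    rw [← add_mul_div_mul_div_eq hQ, ← e5]
    simp only [Y13]
    generalize hd : Dden (Y23 b c (x, y, z)).1 (Y23 b c (x, y, z)).2.2 = d
    simp only [Ymap, hd]
    simp only [Y23, Ymap, Dden, Matrix.cons_val]
    ring
  clear h2 h3 h5 h6
  simp only [Y12, Y13, Y23, Ymap] at e2 e5 e3 e6 ⊢
  simp only [e2, e5] at e3 e6 ⊢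
  simp only [e3, e6]
  clear e2 e3 e5 e6
  generalize Dden x y = p at *
  generalize Dden y z = q at *
  simp only [Matrix.cons_val, Prod.mk.injEq]
  generalize hP' : p * q + (a - b) * (x 1 - z 2) = P at *
  generalize hQ' : p * q + (c - b) * (x 1 - z 2) = Q at *
  refine ⟨?_, ?_, ?_⟩ <;> ext i <;> fin_cases i <;>
    simp only [Matrix.cons_val, Fin.mk_one, Fin.zero_eta, Fin.reduceFinMk] <;>
    field_simp <;> (try subst P Q) <;> ring
end

section
/- Let a, b ∈ ℂ and x, y ∈ ℂ⁴ with D := x₁ − y₄ + x₂y₃ ≠ 0, and let (u, v) = Y_{a,b}(x, y). Then the four quantities I₁ = x₂ + y₂ − x₃ − y₃, I₂ = x₁ + y₁ + x₂y₂, I₃ = x₄ + y₄ − x₃y₃, and I₄ = b(x₂ − x₃) − a(y₃ − y₂) + (x₄ − x₃y₂ − y₁)(x₁ + x₂y₃ − y₄) are invariants of the map, i.e. each Iⱼ evaluated at (u, v) equals Iⱼ evaluated at (x, y). -/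
/-- If `(u,v) = Y_{a,b}(x,y)` (with nonzero denominator `D = x₁ − y₄ + x₂y₃`), then
`I₁ = x₂ + y₂ − x₃ − y₃`, `I₂ = x₁ + y₁ + x₂y₂`, `I₃ = x₄ + y₄ − x₃y₃` and
`I₄ = b(x₂ − x₃) − a(y₃ − y₂) + (x₄ − x₃y₂ − y₁)(x₁ + x₂y₃ − y₄)` are invariants. -/
theorem Ymap_invariants
    (a b x1 x2 x3 x4 y1 y2 y3 y4 u1 u2 u3 u4 v1 v2 v3 v4 : ℂ)
    (hD : x1 - y4 + x2 * y3 ≠ 0)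
    (hu1 : u1 = y1 + (a - b) * x2 / (x1 - y4 + x2 * y3))
    (hu2 : u2 = y2 + (b - a) / (x1 - y4 + x2 * y3))
    (hu3 : u3 = y3)
    (hu4 : u4 = y4)
    (hv1 : v1 = x1)
    (hv2 : v2 = x2)
    (hv3 : v3 = x3 + (b - a) / (x1 - y4 + x2 * y3))
    (hv4 : v4 = x4 + (b - a) * y3 / (x1 - y4 + x2 * y3)) :
    u2 + v2 - u3 - v3 = x2 + y2 - x3 - y3 ∧
    u1 + v1 + u2 * v2 = x1 + y1 + x2 * y2 ∧
    u4 + v4 - u3 * v3 = x4 + y4 - x3 * y3 ∧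
    b * (u2 - u3) - a * (v3 - v2) + (u4 - u3 * v2 - v1) * (u1 + u2 * v3 - v4) =
      b * (x2 - x3) - a * (y3 - y2) + (x4 - x3 * y2 - y1) * (x1 + x2 * y3 - y4) := by
  have ht : (b - a) / (x1 - y4 + x2 * y3) * (x1 - y4 + x2 * y3) = b - a :=
    div_mul_cancel₀ _ hD
  rw [mul_div_right_comm] at hu1 hv4
  rw [← neg_sub b a, neg_div] at hu1
  subst hu1 hu2 hu3 hu4 hv1 hv2 hv3 hv4
  generalize (b - a) / _ = t at *
  refine ⟨by ring, by ring, by ring, ?_⟩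
  linear_combination -(y2 + x3 + t - v2 - u3) * ht
end

section
/- Let a, b ∈ ℂ, let x₁,…,x₄, y₁,…,y₄ ∈ Λ₀ be even and χ₁,χ₂,ψ₁,ψ₂ ∈ Λ₁ odd with D and D₀ invertible, and let ((u,ξ),(v,η)) = S_{a,b}((x,χ),(y,ψ)). Then the quantities χ₁ψ₁ and χ₂ψ₂ are anti-invariants of the map: ξ₁η₁ = −χ₁ψ₁ and ξ₂η₂ = −χ₂ψ₂. -/
open CliffordAlgebra

variable {V : Type*} [AddCommGroup V] [Module ℂ V]

/-- The even part `Λ₀` of the Grassmann (exterior) algebra `Λ = Λ(V)`. -/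
noncomputable def evenPart (V : Type*) [AddCommGroup V] [Module ℂ V] :
    Submodule ℂ (ExteriorAlgebra ℂ V) :=
  evenOdd (0 : QuadraticForm ℂ V) 0

/-- The odd part `Λ₁` of the Grassmann (exterior) algebra `Λ = Λ(V)`. -/
noncomputable def oddPart (V : Type*) [AddCommGroup V] [Module ℂ V] :
    Submodule ℂ (ExteriorAlgebra ℂ V) :=
  evenOdd (0 : QuadraticForm ℂ V) 1

theorem commute_of_mem_evenPart_of_mem_oddPart {x χ : ExteriorAlgebra ℂ V}
    (hx : x ∈ evenPart V) (hχ : χ ∈ oddPart V) : Commute x χ := by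
  have h := commute_map_mul_map_of_isOrtho_of_mem_evenOdd_zero_left
    (QuadraticMap.Isometry.id (0 : QuadraticForm ℂ V))
    (QuadraticMap.Isometry.id (0 : QuadraticForm ℂ V))
    (fun _ _ => by simp [QuadraticMap.IsOrtho]) x χ hx hχ
  simpa only [map_id, AlgHom.id_apply] using h

theorem mul_eq_neg_mul_of_mem_oddPart {χ ψ : ExteriorAlgebra ℂ V}
    (hχ : χ ∈ oddPart V) (hψ : ψ ∈ oddPart V) : χ * ψ = -(ψ * χ) := by
  have h := map_mul_map_eq_neg_of_isOrtho_of_mem_evenOdd_one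
    (QuadraticMap.Isometry.id (0 : QuadraticForm ℂ V))
    (QuadraticMap.Isometry.id (0 : QuadraticForm ℂ V))
    (fun _ _ => by simp [QuadraticMap.IsOrtho]) χ ψ hχ hψ
  simpa only [map_id, AlgHom.id_apply, neg_mul] using h

theorem mul_self_eq_zero_of_mem_oddPart {χ : ExteriorAlgebra ℂ V}
    (hχ : χ ∈ oddPart V) : χ * χ = 0 := by
  have h : (2 : ℂ) • (χ * χ) = 0 := by
    rw [two_smul]
    exact eq_neg_iff_add_eq_zero.mp (mul_eq_neg_mul_of_mem_oddPart hχ hχ)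
  exact (smul_eq_zero_iff_right two_ne_zero).mp h

theorem mul_mem_evenPart {x y : ExteriorAlgebra ℂ V}
    (hx : x ∈ evenPart V) (hy : y ∈ evenPart V) : x * y ∈ evenPart V := by
  have h := evenOdd_mul_le (0 : QuadraticForm ℂ V) 0 0 (Submodule.mul_mem_mul hx hy)
  rwa [add_zero] at h

theorem Commute.ringInverse_left_of_isUnit {M : Type*} [MonoidWithZero M] {a b : M}
    (h : Commute a b) (ha : IsUnit a) : Commute (Ring.inverse a) b := by
  obtain ⟨u, rfl⟩ := ha
  rw [Ring.inverse_unit]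
  exact h.units_inv_left

/-- If `((u,ξ),(v,η)) = S_{a,b}((x,χ),(y,ψ))`, then `χ₁ψ₁` and `χ₂ψ₂` are
anti-invariants: `ξ₁η₁ = −χ₁ψ₁` and `ξ₂η₂ = −χ₂ψ₂`. -/
theorem Smap_anti_invariants
    (a b : ℂ) (x1 x2 x3 x4 y1 y2 y3 y4 χ1 χ2 ψ1 ψ2 : ExteriorAlgebra ℂ V)
    (u1 u2 u3 u4 v1 v2 v3 v4 ξ1 ξ2 η1 η2 : ExteriorAlgebra ℂ V)
    (hx1 : x1 ∈ evenPart V) (hx2 : x2 ∈ evenPart V) (hx3 : x3 ∈ evenPart V)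
    (hx4 : x4 ∈ evenPart V)
    (hy1 : y1 ∈ evenPart V) (hy2 : y2 ∈ evenPart V) (hy3 : y3 ∈ evenPart V)
    (hy4 : y4 ∈ evenPart V)
    (hχ1 : χ1 ∈ oddPart V) (hχ2 : χ2 ∈ oddPart V)
    (hψ1 : ψ1 ∈ oddPart V) (hψ2 : ψ2 ∈ oddPart V)
    (D D0 : ExteriorAlgebra ℂ V)
    (hDdef : D = x1 - y4 + x2 * y3 + χ1 * ψ2)
    (hD0def : D0 = x1 - y4 + x2 * y3)
    (hD : IsUnit D) (hD0 : IsUnit D0)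
    (hu1 : u1 = y1 + (a - b) • (x2 * Ring.inverse D))
    (hu2 : u2 = y2 + (b - a) • Ring.inverse D)
    (hu3 : u3 = y3)
    (hu4 : u4 = y4)
    (hξ1 : ξ1 = ψ1 + (a - b) • (Ring.inverse D0 * χ1))
    (hξ2 : ξ2 = ψ2)
    (hv1 : v1 = x1)
    (hv2 : v2 = x2)
    (hv3 : v3 = x3 + (b - a) • Ring.inverse D)
    (hv4 : v4 = x4 + (b - a) • (y3 * Ring.inverse D))
    (hη1 : η1 = χ1)
    (hη2 : η2 = χ2 + (a - b) • (Ring.inverse D0 * ψ2))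
    :
    ξ1 * η1 = -(χ1 * ψ1) ∧ ξ2 * η2 = -(χ2 * ψ2) := by
  have hD0_even : D0 ∈ evenPart V := by
    rw [hD0def]
    exact add_mem (sub_mem hx1 hy4) (mul_mem_evenPart hx2 hy3)
  have hcomm : Commute (Ring.inverse D0) ψ2 :=
    (commute_of_mem_evenPart_of_mem_oddPart hD0_even hψ2).ringInverse_left_of_isUnit hD0
  subst hξ1 hξ2 hη1 hη2
  constructor
  · rw [add_mul, smul_mul_assoc, mul_assoc, mul_self_eq_zero_of_mem_oddPart hχ1, mul_zero,
      smul_zero, add_zero, mul_eq_neg_mul_of_mem_oddPart hψ1 hχ1]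
  · rw [mul_add, mul_smul_comm, ← mul_assoc, ← hcomm.eq, mul_assoc,
      mul_self_eq_zero_of_mem_oddPart hψ2, mul_zero, smul_zero, add_zero,
      mul_eq_neg_mul_of_mem_oddPart hψ2 hχ2]
end

section
/- Suppose the functions p, q, r : ℤ×ℤ → Λ₀ and τ, θ : ℤ×ℤ → Λ₁ satisfy the Grassmann lattice Boussinesq system at every point of ℤ×ℤ. Then the conservation law (𝒯−1)(p₁₀ + q q₁₀ − r) = (𝒮−1)(p₀₁ + q q₀₁ − r) holds; explicitly, at every (n,m) ∈ ℤ×ℤ, (p₁₁ + q₀₁ q₁₁ − r₀₁) − (p₁₀ + q q₁₀ − r) = (p₁₁ + q₁₀ q₁₁ − r₁₀) − (p₀₁ + q q₀₁ − r). -/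
open CliffordAlgebra

variable {V : Type*} [AddCommGroup V] [Module ℂ V]

/-- The denominator `Δ = p − r₁₁ + q q₁₁ + τ θ₁₁` at the lattice point `(n,m)`. -/
noncomputable def latΔ (p q r τ θ : ℤ × ℤ → ExteriorAlgebra ℂ V) (n m : ℤ) :
    ExteriorAlgebra ℂ V :=
  p (n, m) - r (n + 1, m + 1) + q (n, m) * q (n + 1, m + 1) + τ (n, m) * θ (n + 1, m + 1)

/-- The denominator `Δ₀ = p − r₁₁ + q q₁₁` at the lattice point `(n,m)`. -/
noncomputable def latΔ0 (p q r : ℤ × ℤ → ExteriorAlgebra ℂ V) (n m : ℤ) :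
    ExteriorAlgebra ℂ V :=
  p (n, m) - r (n + 1, m + 1) + q (n, m) * q (n + 1, m + 1)

/-- The Grassmann lattice Boussinesq system: at every point `(n,m)` of `ℤ×ℤ` the
elements `Δ = p − r₁₁ + q q₁₁ + τθ₁₁` and `Δ₀ = p − r₁₁ + q q₁₁` are invertible in `Λ` and
`p₀₁ = p₁₀ + (a−b) q Δ⁻¹`, `q₀₁ = q₁₀ + (b−a) Δ⁻¹`, `r₀₁ = r₁₀ + (b−a) q₁₁ Δ⁻¹`,
`θ₀₁ = θ₁₀ + (a−b) Δ₀⁻¹ θ₁₁`, `τ₀₁ = τ₁₀ + (a−b) Δ₀⁻¹ τ`. -/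
def GrassmannLatticeBSQ (a b : ℂ) (p q r τ θ : ℤ × ℤ → ExteriorAlgebra ℂ V) : Prop :=
  ∀ n m : ℤ,
    IsUnit (latΔ p q r τ θ n m) ∧
    IsUnit (latΔ0 p q r n m) ∧
    p (n, m + 1) = p (n + 1, m) + (a - b) • (q (n, m) * Ring.inverse (latΔ p q r τ θ n m)) ∧
    q (n, m + 1) = q (n + 1, m) + (b - a) • Ring.inverse (latΔ p q r τ θ n m) ∧
    r (n, m + 1) = r (n + 1, m)
      + (b - a) • (q (n + 1, m + 1) * Ring.inverse (latΔ p q r τ θ n m)) ∧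
    θ (n, m + 1) = θ (n + 1, m)
      + (a - b) • (Ring.inverse (latΔ0 p q r n m) * θ (n + 1, m + 1)) ∧
    τ (n, m + 1) = τ (n + 1, m) + (a - b) • (Ring.inverse (latΔ0 p q r n m) * τ (n, m))

/-- Even elements of an exterior algebra commute with vectors. -/
theorem commute_ι_of_mem_evenPart {x : ExteriorAlgebra ℂ V} (hx : x ∈ evenPart V) (v : V) :
    Commute x (ExteriorAlgebra.ι ℂ v) := by
  refine even_induction (0 : QuadraticForm ℂ V)
    (motive := fun x _ => Commute x (ExteriorAlgebra.ι ℂ v)) ?_ ?_ ?_ x hx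
  · exact fun c => Algebra.commutes c _
  · exact fun x y _ _ hx hy => hx.add_left hy
  · intro w₁ w₂ x _ h
    refine Commute.mul_left ?_ h
    have anti (w : V) : ExteriorAlgebra.ι ℂ w * ExteriorAlgebra.ι ℂ v =
        -(ExteriorAlgebra.ι ℂ v * ExteriorAlgebra.ι ℂ w) :=
      eq_neg_of_add_eq_zero_left (ExteriorAlgebra.ι_add_mul_swap w v)
    change ExteriorAlgebra.ι ℂ w₁ * ExteriorAlgebra.ι ℂ w₂ * ExteriorAlgebra.ι ℂ v =
      ExteriorAlgebra.ι ℂ v * (ExteriorAlgebra.ι ℂ w₁ * ExteriorAlgebra.ι ℂ w₂)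
    rw [mul_assoc, anti w₂, mul_neg, ← mul_assoc, anti w₁, neg_mul, neg_neg, mul_assoc]

/-- Even elements of an exterior algebra are central. -/
theorem commute_of_mem_evenPart {x : ExteriorAlgebra ℂ V} (hx : x ∈ evenPart V)
    (y : ExteriorAlgebra ℂ V) : Commute x y := by
  induction y using ExteriorAlgebra.induction with
  | algebraMap c => exact (Algebra.commutes c x).symm
  | ι v => exact commute_ι_of_mem_evenPart hx v
  | mul y z hy hz => exact hy.mul_right hz
  | add y z hy hz => exact hy.add_right hz

/-- Conservation law `(𝒯−1)(p₁₀ + q q₁₀ − r) = (𝒮−1)(p₀₁ + q q₀₁ − r)` for solutions of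
the Grassmann lattice Boussinesq system. -/
theorem grassmannLatticeBSQ_conservation (a b : ℂ)
    (p q r τ θ : ℤ × ℤ → ExteriorAlgebra ℂ V)
    (hp : ∀ x, p x ∈ evenPart V) (hq : ∀ x, q x ∈ evenPart V)
    (hr : ∀ x, r x ∈ evenPart V)
    (hτ : ∀ x, τ x ∈ oddPart V) (hθ : ∀ x, θ x ∈ oddPart V)
    (hsys : GrassmannLatticeBSQ a b p q r τ θ) :
    ∀ n m : ℤ,
      (p (n + 1, m + 1) + q (n, m + 1) * q (n + 1, m + 1) - r (n, m + 1))
          - (p (n + 1, m) + q (n, m) * q (n + 1, m) - r (n, m)) =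
        (p (n + 1, m + 1) + q (n + 1, m) * q (n + 1, m + 1) - r (n + 1, m))
          - (p (n, m + 1) + q (n, m) * q (n, m + 1) - r (n, m)) := by
  intro n m
  obtain ⟨-, -, hp₀₁, hq₀₁, hr₀₁, -, -⟩ := hsys n m
  have hcomm := (commute_of_mem_evenPart (hq (n + 1, m + 1))
    (Ring.inverse (latΔ p q r τ θ n m))).eq
  rw [hp₀₁, hq₀₁, hr₀₁, hcomm]
  simp only [add_mul, mul_add, smul_mul_assoc, mul_smul_comm]
  simp only [sub_smul]
  abel
end

section
/- Assume additionally that 𝒜 := q₁₀₀(r₀₁₀ − r₀₀₁) + q₀₁₀(r₀₀₁ − r₁₀₀) + q₀₀₁(r₁₀₀ − r₀₁₀) is invertible in R. Then q₀₁₁ − q₁₀₁ is invertible, and the values obtained by applying the face map once more on the top face with parameters (a,b) and base point (p₀₀₁, q₀₀₁), namely p₁₁₁ = (r₁₀₁ q₀₁₁ − r₀₁₁ q₁₀₁)(q₀₁₁ − q₁₀₁)⁻¹, q₁₁₁ = (r₀₁₁ − r₁₀₁)(q₀₁₁ − q₁₀₁)⁻¹, r₁₁₁ = (b − a + q₀₀₁(r₀₁₁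 − r₁₀₁) + p₀₀₁(q₀₁₁ − q₁₀₁))(q₀₁₁ − q₁₀₁)⁻¹, θ₁₁₁ = (q₀₁₁ − q₁₀₁)⁻¹ • (θ₀₁₁ − θ₁₀₁), admit the closed forms: p₁₁₁ = p − (a(r₀₀₁ − r₀₁₀) + b(r₁₀₀ − r₀₀₁) + c(r₀₁₀ − r₁₀₀))𝒜⁻¹; q₁₁₁ = q + (a(q₀₀₁ − q₀₁₀) + b(q₁₀₀ − q₀₀₁) + c(q₀₁₀ − q₁₀₀))𝒜⁻¹; r₁₁₁ = r + (a q₁₀₀(q₀₀₁ − q₀₁₀) + b q₀₁₀(q₁₀₀ − q₀₀₁) + c q₀₀₁(q₀₁₀ − q₁₀₀))𝒜⁻¹; θ₁₁₁ = 𝒜⁻¹ • ((q₀₀₁ − q₁₀₀) • (θ₀₀₁ − θ₀₁₀) − (q₀₀₁ − q₀₁₀) • (θ₀₀₁ − θ₁₀₀)). -/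
/-- Closed forms of the `111`-values of the Grassmann Boussinesq-type system obtained by
applying the face map on the top face (parameters `(a,b)`, base point `(p₀₀₁, q₀₀₁)`),
assuming `𝒜 = q₁₀₀(r₀₁₀ − r₀₀₁) + q₀₁₀(r₀₀₁ − r₁₀₀) + q₀₀₁(r₁₀₀ − r₀₁₀)` is invertible. -/
theorem cube_111_closed_forms
    {R : Type*} [CommRing R] {M : Type*} [AddCommGroup M] [Module R M]
    (a b c p q r q100 q010 q001 r100 r010 r001 : R) (θ100 θ010 θ001 : M)
    (p100 p010 p001 : R)
    (hp100 : p100 = r - q * q100) (hp010 : p010 = r - q * q010)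
    (hp001 : p001 = r - q * q001)
    (h1 : IsUnit (q010 - q100)) (h2 : IsUnit (q001 - q100))
    (h3 : IsUnit (q001 - q010))
    -- bottom-face values (parameters a, b)
    (p110 q110 r110 : R) (θ110 : M)
    (hp110 : p110 = (r100 * q010 - r010 * q100) * Ring.inverse (q010 - q100))
    (hq110 : q110 = (r010 - r100) * Ring.inverse (q010 - q100))
    (hr110 : r110 = (b - a + q * (r010 - r100) + p * (q010 - q100))
      * Ring.inverse (q010 - q100))
    (hθ110 : θ110 = Ring.inverse (q010 - q100) • (θ010 - θ100))
    -- front-face values (parameters a, c)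
    (p101 q101 r101 : R) (θ101 : M)
    (hp101 : p101 = (r100 * q001 - r001 * q100) * Ring.inverse (q001 - q100))
    (hq101 : q101 = (r001 - r100) * Ring.inverse (q001 - q100))
    (hr101 : r101 = (c - a + q * (r001 - r100) + p * (q001 - q100))
      * Ring.inverse (q001 - q100))
    (hθ101 : θ101 = Ring.inverse (q001 - q100) • (θ001 - θ100))
    -- left-face values (parameters b, c)
    (p011 q011 r011 : R) (θ011 : M)
    (hp011 : p011 = (r010 * q001 - r001 * q010) * Ring.inverse (q001 - q010))
    (hq011 : q011 = (r001 - r010) * Ring.inverse (q001 - q010))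
    (hr011 : r011 = (c - b + q * (r001 - r010) + p * (q001 - q010))
      * Ring.inverse (q001 - q010))
    (hθ011 : θ011 = Ring.inverse (q001 - q010) • (θ001 - θ010))
    -- invertibility of 𝒜
    (hA : IsUnit (q100 * (r010 - r001) + q010 * (r001 - r100) + q001 * (r100 - r010)))
    :
    IsUnit (q011 - q101) ∧
    (r101 * q011 - r011 * q101) * Ring.inverse (q011 - q101) =
      p - (a * (r001 - r010) + b * (r100 - r001) + c * (r010 - r100))
        * Ring.inverse (q100 * (r010 - r001) + q010 * (r001 - r100)
            + q001 * (r100 - r010)) ∧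
    (r011 - r101) * Ring.inverse (q011 - q101) =
      q + (a * (q001 - q010) + b * (q100 - q001) + c * (q010 - q100))
        * Ring.inverse (q100 * (r010 - r001) + q010 * (r001 - r100)
            + q001 * (r100 - r010)) ∧
    (b - a + q001 * (r011 - r101) + p001 * (q011 - q101)) * Ring.inverse (q011 - q101) =
      r + (a * q100 * (q001 - q010) + b * q010 * (q100 - q001)
            + c * q001 * (q010 - q100))
        * Ring.inverse (q100 * (r010 - r001) + q010 * (r001 - r100)
            + q001 * (r100 - r010)) ∧
    Ring.inverse (q011 - q101) • (θ011 - θ101) =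
      Ring.inverse (q100 * (r010 - r001) + q010 * (r001 - r100) + q001 * (r100 - r010)) •
        ((q001 - q100) • (θ001 - θ010) - (q001 - q010) • (θ001 - θ100)) := by
  subst hp001 hθ101 hθ011
  have hX := Ring.mul_inverse_cancel _ h2
  have hY := Ring.mul_inverse_cancel _ h3
  have hw := Ring.mul_inverse_cancel _ hA
  generalize Ring.inverse (q001 - q100) = u at *
  generalize Ring.inverse (q001 - q010) = v at *
  generalize Ring.inverse (q100 * (r010 - r001) + q010 * (r001 - r100)
    + q001 * (r100 - r010)) = w at *
  have hq2 : q101 * (q001 - q100) = r001 - r100 := by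
    linear_combination (q001 - q100) * hq101 + (r001 - r100) * hX
  have hq3 : q011 * (q001 - q010) = r001 - r010 := by
    linear_combination (q001 - q010) * hq011 + (r001 - r010) * hY
  have hr2 : r101 * (q001 - q100) = c - a + q * (r001 - r100) + p * (q001 - q100) := by
    linear_combination (q001 - q100) * hr101
      + (c - a + q * (r001 - r100) + p * (q001 - q100)) * hX
  have hr3 : r011 * (q001 - q010) = c - b + q * (r001 - r010) + p * (q001 - q010) := by
    linear_combination (q001 - q010) * hr011
      + (c - b + q * (r001 - r010) + p * (q001 - q010)) * hY
  have hD : (q011 - q101) * ((q001 - q100) * (q001 - q010) * w) = 1 := by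
    linear_combination w * (q001 - q100) * hq3 - w * (q001 - q010) * hq2 + hw
  have hunit : IsUnit (q011 - q101) := IsUnit.of_mul_eq_one _ hD
  have hinv : Ring.inverse (q011 - q101) = (q001 - q100) * (q001 - q010) * w :=
    hunit.mul_left_cancel ((Ring.mul_inverse_cancel _ hunit).trans hD.symm)
  have hq111 : (r011 - r101) * ((q001 - q100) * (q001 - q010) * w) =
      q + (a * (q001 - q010) + b * (q100 - q001) + c * (q010 - q100)) * w := by
    linear_combination w * (q001 - q100) * hr3 - w * (q001 - q010) * hr2 + q * hw
  rw [hinv]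
  refine ⟨hunit, ?_, hq111, ?_, ?_⟩
  · linear_combination w * (q011 * (q001 - q010) * hr2
      + (c - a + q * (r001 - r100) + p * (q001 - q100)) * hq3
      - q101 * (q001 - q100) * hr3
      - (c - b + q * (r001 - r010) + p * (q001 - q010)) * hq2) + p * hw
  · linear_combination q001 * hq111 + (r - q * q001) * hD
  · have hu : (q001 - q100) * (q001 - q010) * w * u = w * (q001 - q010) := by
      linear_combination (q001 - q010) * w * hX
    have hv : (q001 - q100) * (q001 - q010) * w * v = w * (q001 - q100) := by
      linear_combination (q001 - q100) * w * hY
    rw [smul_sub _ (v • _), smul_sub w, smul_smul, smul_smul, smul_smul, smul_smul, hu, hv]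
end

section
/- 3D consistency of the Grassmann Boussinesq-type system: assume additionally that 𝒜 := q₁₀₀(r₀₁₀ − r₀₀₁) + q₀₁₀(r₀₀₁ − r₁₀₀) + q₀₀₁(r₁₀₀ − r₀₁₀) is invertible in R. Then the three differences q₀₁₁ − q₁₀₁, q₀₁₁ − q₁₁₀ and q₁₀₁ − q₁₁₀ are invertible in R, and the three ways of computing the quadruple (p₁₁₁, q₁₁₁, r₁₁₁, θ₁₁₁) coincide: (A) via the top face with parameters (a,b) and base (p₀₀₁, q₀₀₁): p₁₁₁ = (r₁₀₁ q₀₁₁ − r₀₁₁ q₁₀₁)(q₀₁₁ − q₁₀₁)⁻¹, q₁₁₁ = (r₀₁₁ − r₁₀₁)(q₀₁₁ − q₁₀₁)⁻¹, r₁₁₁ = (b − a + q₀₀₁(r₀₁₁ − r₁₀₁) + p₀₀₁(q₀₁₁ − q₁₀₁))(q₀₁₁ − q₁₀₁)⁻¹, θ₁₁₁ = (q₀₁₁ − q₁₀₁)⁻¹ • (θ₀₁₁ − θ₁₀₁); (B) via the back face with parameters (a,c) and base (p₀₁₀, q₀₁₀): p₁₁₁ = (r₁₁₀ q₀₁₁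 − r₀₁₁ q₁₁₀)(q₀₁₁ − q₁₁₀)⁻¹, q₁₁₁ = (r₀₁₁ − r₁₁₀)(q₀₁₁ − q₁₁₀)⁻¹, r₁₁₁ = (c − a + q₀₁₀(r₀₁₁ − r₁₁₀) + p₀₁₀(q₀₁₁ − q₁₁₀))(q₀₁₁ − q₁₁₀)⁻¹, θ₁₁₁ = (q₀₁₁ − q₁₁₀)⁻¹ • (θ₀₁₁ − θ₁₁₀); (C) via the right face with parameters (b,c) and base (p₁₀₀, q₁₀₀): p₁₁₁ = (r₁₁₀ q₁₀₁ − r₁₀₁ q₁₁₀)(q₁₀₁ − q₁₁₀)⁻¹, q₁₁₁ = (r₁₀₁ − r₁₁₀)(q₁₀₁ − q₁₁₀)⁻¹, r₁₁₁ = (c − b + q₁₀₀(r₁₀₁ − r₁₁₀) + p₁₀₀(q₁₀₁ − q₁₁₀))(q₁₀₁ − q₁₁₀)⁻¹, θ₁₁₁ = (q₁₀₁ − q₁₁₀)⁻¹ • (θ₁₀₁ − θ₁₁₀). All four components of (p₁₁₁, q₁₁₁, r₁₁₁, θ₁₁₁) computed via (A), (B) and (C) are equal. -/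
theorem Ring.inverse_mul_smul_smul {R M : Type*} [CommRing R] [AddCommGroup M] [Module R M]
    {h : R} (hh : IsUnit h) (x : R) (m : M) :
    Ring.inverse (h * x) • h • m = Ring.inverse x • m := by
  rw [Ring.mul_inverse_rev, smul_smul, mul_assoc, Ring.inverse_mul_cancel _ hh, mul_one]

/-- If each of three pairs `(kᵢ, mᵢ)` is a unit multiple of one pair `(x, m)`, then the
quotients `kᵢ⁻¹ • mᵢ` agree. -/
theorem inverse_smul_eq_of_unit_multiples {R M : Type*} [CommRing R] [AddCommGroup M]
    [Module R M] {h₁ h₂ h₃ k₁ k₂ k₃ x : R} {m₁ m₂ m₃ : M} (m : M)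
    (u₁ : IsUnit h₁) (u₂ : IsUnit h₂) (u₃ : IsUnit h₃)
    (hk₁ : k₁ = h₁ * x) (hk₂ : k₂ = h₂ * x) (hk₃ : k₃ = h₃ * x)
    (hm₁ : m₁ = h₁ • m) (hm₂ : m₂ = h₂ • m) (hm₃ : m₃ = h₃ • m) :
    Ring.inverse k₁ • m₁ = Ring.inverse k₂ • m₂ ∧
      Ring.inverse k₁ • m₁ = Ring.inverse k₃ • m₃ := by
  subst hk₁ hk₂ hk₃ hm₁ hm₂ hm₃
  simp only [Ring.inverse_mul_smul_smul u₁, Ring.inverse_mul_smul_smul u₂,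
    Ring.inverse_mul_smul_smul u₃, and_self]

theorem inverse_mul_eq_of_unit_multiples {R : Type*} [CommRing R]
    {h₁ h₂ h₃ k₁ k₂ k₃ x m₁ m₂ m₃ : R} (m : R)
    (u₁ : IsUnit h₁) (u₂ : IsUnit h₂) (u₃ : IsUnit h₃)
    (hk₁ : k₁ = h₁ * x) (hk₂ : k₂ = h₂ * x) (hk₃ : k₃ = h₃ * x)
    (hm₁ : m₁ = h₁ * m) (hm₂ : m₂ = h₂ * m) (hm₃ : m₃ = h₃ * m) :
    m₁ * Ring.inverse k₁ = m₂ * Ring.inverse k₂ ∧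
      m₁ * Ring.inverse k₁ = m₃ * Ring.inverse k₃ := by
  simpa only [smul_eq_mul, mul_comm] using
    inverse_smul_eq_of_unit_multiples m u₁ u₂ u₃ hk₁ hk₂ hk₃ hm₁ hm₂ hm₃

/-- 3D consistency of the Grassmann Boussinesq-type system: if
`𝒜 = q₁₀₀(r₀₁₀ − r₀₀₁) + q₀₁₀(r₀₀₁ − r₁₀₀) + q₀₀₁(r₁₀₀ − r₀₁₀)` is invertible, then
`q₀₁₁ − q₁₀₁`, `q₀₁₁ − q₁₁₀`, `q₁₀₁ − q₁₁₀` are invertible and the three ways (A) (top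
face), (B) (back face) and (C) (right face) of computing `(p₁₁₁, q₁₁₁, r₁₁₁, θ₁₁₁)`
coincide. -/
theorem cube_3D_consistency
    {R : Type*} [CommRing R] {M : Type*} [AddCommGroup M] [Module R M]
    (a b c p q r q100 q010 q001 r100 r010 r001 : R) (θ100 θ010 θ001 : M)
    (p100 p010 p001 : R)
    (hp100 : p100 = r - q * q100) (hp010 : p010 = r - q * q010)
    (hp001 : p001 = r - q * q001)
    (h1 : IsUnit (q010 - q100)) (h2 : IsUnit (q001 - q100))
    (h3 : IsUnit (q001 - q010))
    -- bottom-face values (parameters a, b)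
    (p110 q110 r110 : R) (θ110 : M)
    (hp110 : p110 = (r100 * q010 - r010 * q100) * Ring.inverse (q010 - q100))
    (hq110 : q110 = (r010 - r100) * Ring.inverse (q010 - q100))
    (hr110 : r110 = (b - a + q * (r010 - r100) + p * (q010 - q100))
      * Ring.inverse (q010 - q100))
    (hθ110 : θ110 = Ring.inverse (q010 - q100) • (θ010 - θ100))
    -- front-face values (parameters a, c)
    (p101 q101 r101 : R) (θ101 : M)
    (hp101 : p101 = (r100 * q001 - r001 * q100) * Ring.inverse (q001 - q100))
    (hq101 : q101 = (r001 - r100) * Ring.inverse (q001 - q100))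
    (hr101 : r101 = (c - a + q * (r001 - r100) + p * (q001 - q100))
      * Ring.inverse (q001 - q100))
    (hθ101 : θ101 = Ring.inverse (q001 - q100) • (θ001 - θ100))
    -- left-face values (parameters b, c)
    (p011 q011 r011 : R) (θ011 : M)
    (hp011 : p011 = (r010 * q001 - r001 * q010) * Ring.inverse (q001 - q010))
    (hq011 : q011 = (r001 - r010) * Ring.inverse (q001 - q010))
    (hr011 : r011 = (c - b + q * (r001 - r010) + p * (q001 - q010))
      * Ring.inverse (q001 - q010))
    (hθ011 : θ011 = Ring.inverse (q001 - q010) • (θ001 - θ010))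
    -- invertibility of 𝒜
    (hA : IsUnit (q100 * (r010 - r001) + q010 * (r001 - r100) + q001 * (r100 - r010)))
    :
    IsUnit (q011 - q101) ∧ IsUnit (q011 - q110) ∧ IsUnit (q101 - q110) ∧
    -- p₁₁₁ : (A) = (B) and (A) = (C)
    ((r101 * q011 - r011 * q101) * Ring.inverse (q011 - q101) =
      (r110 * q011 - r011 * q110) * Ring.inverse (q011 - q110) ∧
     (r101 * q011 - r011 * q101) * Ring.inverse (q011 - q101) =
      (r110 * q101 - r101 * q110) * Ring.inverse (q101 - q110)) ∧
    -- q₁₁₁ : (A) = (B) and (A) = (C)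
    ((r011 - r101) * Ring.inverse (q011 - q101) =
      (r011 - r110) * Ring.inverse (q011 - q110) ∧
     (r011 - r101) * Ring.inverse (q011 - q101) =
      (r101 - r110) * Ring.inverse (q101 - q110)) ∧
    -- r₁₁₁ : (A) = (B) and (A) = (C)
    ((b - a + q001 * (r011 - r101) + p001 * (q011 - q101))
        * Ring.inverse (q011 - q101) =
      (c - a + q010 * (r011 - r110) + p010 * (q011 - q110))
        * Ring.inverse (q011 - q110) ∧
     (b - a + q001 * (r011 - r101) + p001 * (q011 - q101))
        * Ring.inverse (q011 - q101) =
      (c - b + q100 * (r101 - r110) + p100 * (q101 - q110))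
        * Ring.inverse (q101 - q110)) ∧
    -- θ₁₁₁ : (A) = (B) and (A) = (C)
    (Ring.inverse (q011 - q101) • (θ011 - θ101) =
      Ring.inverse (q011 - q110) • (θ011 - θ110) ∧
     Ring.inverse (q011 - q101) • (θ011 - θ101) =
      Ring.inverse (q101 - q110) • (θ101 - θ110)) := by
  have hD := Ring.mul_inverse_cancel _ h1
  have hE := Ring.mul_inverse_cancel _ h2
  have hF := Ring.mul_inverse_cancel _ h3
  have uD := h1.ringInverse
  have uE := h2.ringInverse
  have uF := h3.ringInverse
  generalize Ring.inverse (q010 - q100) = D at *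
  generalize Ring.inverse (q001 - q100) = E at *
  generalize Ring.inverse (q001 - q010) = F at *
  have hr110' : r110 = (b - a) * D + q * q110 + p := by
    linear_combination hr110 - q * hq110 + p * hD
  have hr101' : r101 = (c - a) * E + q * q101 + p := by
    linear_combination hr101 - q * hq101 + p * hE
  have hr011' : r011 = (c - b) * F + q * q011 + p := by
    linear_combination hr011 - q * hq011 + p * hF
  generalize hA' : q100 * (r010 - r001) + q010 * (r001 - r100) + q001 * (r100 - r010) = A at hA
  have hq₁ : q011 - q101 = E * F * A := by
    linear_combination hq011 - hq101 + E * F * hA' - (r001 - r010) * F * hE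
      + (r001 - r100) * E * hF
  have hq₂ : q011 - q110 = D * F * A := by
    linear_combination hq011 - hq110 + D * F * hA' - (r001 - r010) * F * hD
      + (r010 - r100) * D * hF
  have hq₃ : q101 - q110 = D * E * A := by
    linear_combination hq101 - hq110 + D * E * hA' - (r001 - r100) * E * hD
      + (r010 - r100) * D * hE
  have uEF := uE.mul uF
  have uDF := uD.mul uF
  have uDE := uD.mul uE
  -- the common numerator of `q₁₁₁`
  let N := c * (q010 - q100) - b * (q001 - q100) + a * (q001 - q010) + q * A
  have hN₁ : r011 - r101 = E * F * N := by
    linear_combination hr011' - hr101' + q * hq₁ - (c - b) * F * hE + (c - a) * E * hF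
  have hN₂ : r011 - r110 = D * F * N := by
    linear_combination hr011' - hr110' + q * hq₂ - (c - b) * F * hD + (b - a) * D * hF
  have hN₃ : r101 - r110 = D * E * N := by
    linear_combination hr101' - hr110' + q * hq₃ - (c - a) * E * hD + (b - a) * D * hE
  refine ⟨hq₁ ▸ uEF.mul hA, hq₂ ▸ uDF.mul hA, hq₃ ▸ uDE.mul hA, ?_, ?_, ?_, ?_⟩
  · refine inverse_mul_eq_of_unit_multiples
      ((c - a) * (r001 - r010) - (c - b) * (r001 - r100) + p * A)
      uEF uDF uDE hq₁ hq₂ hq₃ ?_ ?_ ?_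
    · linear_combination q011 * hr101' - q101 * hr011' + p * hq₁
        + (c - a) * E * hq011 - (c - b) * F * hq101
    · linear_combination q011 * hr110' - q110 * hr011' + p * hq₂
        + (b - a) * D * hq011 - (c - b) * F * hq110
    · linear_combination q101 * hr110' - q110 * hr101' + p * hq₃
        + (b - a) * D * hq101 - (c - a) * E * hq110
  · exact inverse_mul_eq_of_unit_multiples N uEF uDF uDE hq₁ hq₂ hq₃ hN₁ hN₂ hN₃
  · refine inverse_mul_eq_of_unit_multiples
      (c * q001 * (q010 - q100) - b * q010 * (q001 - q100) + a * q100 * (q001 - q010) + r * A)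
      uEF uDF uDE hq₁ hq₂ hq₃ ?_ ?_ ?_
    · linear_combination q001 * hN₁ + p001 * hq₁ + E * F * A * hp001
        - (b - a) * (hF + (q001 - q010) * F * hE)
    · linear_combination q010 * hN₂ + p010 * hq₂ + D * F * A * hp010
        - (c - a) * (hF + (q001 - q010) * F * hD)
    · linear_combination q100 * hN₃ + p100 * hq₃ + D * E * A * hp100
        - (c - b) * (hE + (q001 - q100) * E * hD)
  · refine inverse_smul_eq_of_unit_multiples
      ((q010 - q100) • θ001 - (q001 - q100) • θ010 + (q001 - q010) • θ100)
      uEF uDF uDE hq₁ hq₂ hq₃ ?_ ?_ ?_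
    · linear_combination (norm := module) hθ011 - hθ101 - hE • F • (θ001 - θ010)
        + hF • E • (θ001 - θ100)
    · linear_combination (norm := module) hθ011 - hθ110 - hD • F • (θ001 - θ010)
        + hF • D • (θ010 - θ100)
    · linear_combination (norm := module) hθ101 - hθ110 - hD • E • (θ001 - θ100)
        + hE • D • (θ010 - θ100)
end
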